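/- arXiv:1801.02926 — 4 statements merged into one kernel-verified Lean document; each statement's English description precedes it below -/
import Mathlib

section
/- Let H be the Hamiltonian of the Lagrange top in Euler angles on the open set U = {(φ, θ, ψ, p_φ, p_θ, p_ψ) ∈ ℝ⁶ : sin θ ≠ 0 and p_φ − p_ψ cos θ ≠ 0}, and let K₂ be the diagonal operator field on U with entries (K₂)_{11} = (K₂)_{44} = A sin²θ/(p_φ − p_ψ cos θ) and all other entries zero (coordinates ordered (φ, θ, ψ, p_φ, p_θ, p_ψ)). Then at every point of U, K₂ᵀ·∇H = ∇H₂ where H₂ = p_φ; i.e. K₂ᵀ·∇H equals the standard basis vector e₄. -/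
open Matrix BigOperators Real

/-- The gradient of a function on `ℝ⁶`, as the vector of partial derivatives. -/
noncomputable def grad (H : (Fin 6 → ℝ) → ℝ) (x : Fin 6 → ℝ) : Fin 6 → ℝ :=
  fun i => fderiv ℝ H x (Pi.single i 1)

/-- The Hamiltonian of the Lagrange top in the Euler angles chart
`(φ, θ, ψ, p_φ, p_θ, p_ψ) = (x 0, x 1, x 2, x 3, x 4, x 5)`. -/
noncomputable def lagrangeH (A c μ g a : ℝ) (x : Fin 6 → ℝ) : ℝ :=
  (1 / (2 * A)) * ((x 4) ^ 2 + (x 3 - x 5 * cos (x 1)) ^ 2 / (sin (x 1)) ^ 2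
      + (x 5) ^ 2 / c)
    + μ * g * a * cos (x 1)

/-- The Haantjes operator `K₂` of the Lagrange top in Euler angles: diagonal with
entries `A sin²θ/(p_φ − p_ψ cos θ)` in positions `(1,1)` and `(4,4)`. -/
noncomputable def lagrangeK₂ (A : ℝ) (x : Fin 6 → ℝ) : Matrix (Fin 6) (Fin 6) ℝ :=
  Matrix.diagonal fun i =>
    if i = 0 ∨ i = 3 then A * (sin (x 1)) ^ 2 / (x 3 - x 5 * cos (x 1)) else 0

theorem grad_eq_lineDeriv {H : (Fin 6 → ℝ) → ℝ} {x : Fin 6 → ℝ} (h : DifferentiableAt ℝ H x)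
    (i : Fin 6) : grad H x i = lineDeriv ℝ H x (Pi.single i 1) :=
  h.lineDeriv_eq_fderiv.symm

theorem differentiableAt_lagrangeH (A c μ g a : ℝ) {x : Fin 6 → ℝ} (hx : sin (x 1) ≠ 0) :
    DifferentiableAt ℝ (lagrangeH A c μ g a) x := by
  have h : (sin (x 1)) ^ 2 ≠ 0 := pow_ne_zero 2 hx
  unfold lagrangeH
  fun_prop (disch := assumption)

/-- The angle `φ` is cyclic. -/
theorem grad_lagrangeH_zero (A c μ g a : ℝ) {x : Fin 6 → ℝ} (hx : sin (x 1) ≠ 0) :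
    grad (lagrangeH A c μ g a) x 0 = 0 := by
  rw [grad_eq_lineDeriv (differentiableAt_lagrangeH A c μ g a hx)]
  simp [lineDeriv, lagrangeH]

theorem grad_lagrangeH_three (A c μ g a : ℝ) {x : Fin 6 → ℝ} (hx : sin (x 1) ≠ 0) :
    grad (lagrangeH A c μ g a) x 3 = (x 3 - x 5 * cos (x 1)) / (A * (sin (x 1)) ^ 2) := by
  rw [grad_eq_lineDeriv (differentiableAt_lagrangeH A c μ g a hx)]
  have h : HasDerivAt (fun t : ℝ => (1 / (2 * A)) * ((x 4) ^ 2 +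
      (x 3 + t - x 5 * cos (x 1)) ^ 2 / (sin (x 1)) ^ 2 + (x 5) ^ 2 / c) + μ * g * a * cos (x 1))
      ((1 / (2 * A)) * (2 * (x 3 + 0 - x 5 * cos (x 1)) / (sin (x 1)) ^ 2)) 0 := by
    have h₁ := (((hasDerivAt_id (0 : ℝ)).const_add (x 3)).sub_const (x 5 * cos (x 1))).pow 2
    simpa using ((((h₁.div_const ((sin (x 1)) ^ 2)).const_add ((x 4) ^ 2)).add_const
      ((x 5) ^ 2 / c)).const_mul (1 / (2 * A))).add_const (μ * g * a * cos (x 1))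
  rw [lineDeriv]
  convert h.deriv using 1
  · simp [lagrangeH]
  · field_simp
    ring

/-- On the Euler-angles chart, `K₂ᵀ·∇H = ∇H₂ = e₄` where `H₂ = p_φ`. -/
theorem lagrange_K2_chain (A c μ g a : ℝ) (hA : A > 0) (hc : c > 0) :
    ∀ x : Fin 6 → ℝ, sin (x 1) ≠ 0 → x 3 - x 5 * cos (x 1) ≠ 0 →
      (lagrangeK₂ A x)ᵀ *ᵥ grad (lagrangeH A c μ g a) x
        = Pi.single (3 : Fin 6) (1 : ℝ) := by
  intro x hx hp
  ext i
  rw [lagrangeK₂, diagonal_transpose, mulVec_diagonal]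
  fin_cases i
  · simp [grad_lagrangeH_zero A c μ g a hx]
  · simp
  · simp
  · simp [grad_lagrangeH_three A c μ g a hx]
    field_simp
  · simp
  · simp
end

section
/- Let c ≠ 0 be a real constant. The Lagrange vector field X_L on ℝ⁶ admits a tri-Hamiltonian formulation: at every point m = (ω₁, ω₂, ω₃, γ₁, γ₂, γ₃) ∈ ℝ⁶, P₀(m)·∇h₀(m) = X_L(m), P₁(m)·∇h₁(m) = X_L(m), and P₂(m)·∇h₂(m) = X_L(m), where h₀ = F₄/2 + (c−1) F₁ F₃, h₁ = −F₃ − (c−1) F₁ F₂, h₂ = F₂. -/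
open Matrix BigOperators

/-- The Lagrange vector field on `ℝ⁶` with coordinates
`m = (ω₁, ω₂, ω₃, γ₁, γ₂, γ₃)` (with the normalization `μga/𝒜 = 1`). -/
def XL (c : ℝ) (m : Fin 6 → ℝ) : Fin 6 → ℝ :=
  ![(1 - c) * m 1 * m 2 - m 4,
    -(1 - c) * m 2 * m 0 + m 3,
    0,
    m 4 * m 2 - m 5 * m 1,
    m 5 * m 0 - m 3 * m 2,
    m 3 * m 1 - m 4 * m 0]

/-- Integrals of motion of the Lagrange top. -/
def F₁ (m : Fin 6 → ℝ) : ℝ := m 2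
noncomputable def F₂ (c : ℝ) (m : Fin 6 → ℝ) : ℝ := (1 / 2) * ((m 0) ^ 2 + (m 1) ^ 2 + c * (m 2) ^ 2) - m 5
def F₃ (c : ℝ) (m : Fin 6 → ℝ) : ℝ := m 0 * m 3 + m 1 * m 4 + c * m 2 * m 5
def F₄ (m : Fin 6 → ℝ) : ℝ := (m 3) ^ 2 + (m 4) ^ 2 + (m 5) ^ 2

/-- The three Hamiltonians of the tri-Hamiltonian formulation. -/
noncomputable def h₀ (c : ℝ) (m : Fin 6 → ℝ) : ℝ := (1 / 2) * F₄ m + (c - 1) * F₁ m * F₃ c m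
noncomputable def h₁ (c : ℝ) (m : Fin 6 → ℝ) : ℝ := -F₃ c m - (c - 1) * F₁ m * F₂ c m
noncomputable def h₂ (c : ℝ) (m : Fin 6 → ℝ) : ℝ := F₂ c m

/-- The Poisson bivector `P₀ = [[0, B], [B, C]]`. -/
noncomputable def P₀ (c : ℝ) (m : Fin 6 → ℝ) : Matrix (Fin 6) (Fin 6) ℝ :=
  !![0,  0,  0,  0,        -1,        0;
     0,  0,  0,  1,        0,         0;
     0,  0,  0,  0,        0,         0;
     0,  -1, 0,  0,        c * m 2,   -m 1;
     1,  0,  0,  -c * m 2, 0,         m 0;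
     0,  0,  0,  m 1,      -m 0,      0]

/-- The Poisson bivector `P₁ = [[−B, 0], [0, Γ]]`. -/
noncomputable def P₁ (m : Fin 6 → ℝ) : Matrix (Fin 6) (Fin 6) ℝ :=
  !![0,  1,  0,  0,     0,     0;
     -1, 0,  0,  0,     0,     0;
     0,  0,  0,  0,     0,     0;
     0,  0,  0,  0,     m 5,   -m 4;
     0,  0,  0,  -m 5,  0,     m 3;
     0,  0,  0,  m 4,   -m 3,  0]

/-- The Poisson bivector `P₂ = [[T, R], [−Rᵀ, 0]]`. -/
noncomputable def P₂ (c : ℝ) (m : Fin 6 → ℝ) : Matrix (Fin 6) (Fin 6) ℝ :=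
  !![0,        -c * m 2,  m 1 / c,   0,        -m 5,      m 4;
     c * m 2,  0,         -m 0 / c,  m 5,      0,         -m 3;
     -m 1 / c, m 0 / c,   0,         -m 4 / c, m 3 / c,   0;
     0,        -m 5,      m 4 / c,   0,        0,         0;
     m 5,      0,         -m 3 / c,  0,        0,         0;
     -m 4,     m 3,       0,         0,        0,         0]

theorem HasFDerivAt.grad_eq {H : (Fin 6 → ℝ) → ℝ} {H' : (Fin 6 → ℝ) →L[ℝ] ℝ} {m : Fin 6 → ℝ}
    (h : HasFDerivAt H H' m) : grad H m = fun i => H' (Pi.single i 1) := by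
  funext i
  rw [grad, h.fderiv]

theorem hasFDerivAt_F₁ (m : Fin 6 → ℝ) :
    HasFDerivAt F₁ (ContinuousLinearMap.proj (R := ℝ) (φ := fun _ : Fin 6 => ℝ) 2) m :=
  hasFDerivAt_apply 2 m

theorem differentiable_F₂ (c : ℝ) : Differentiable ℝ (F₂ c) := by
  unfold F₂
  fun_prop

theorem differentiable_F₃ (c : ℝ) : Differentiable ℝ (F₃ c) := by
  unfold F₃
  fun_prop

theorem differentiable_F₄ : Differentiable ℝ F₄ := by
  unfold F₄
  fun_prop

theorem grad_F₂ (c : ℝ) (m : Fin 6 → ℝ) :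
    grad (F₂ c) m = ![m 0, m 1, c * m 2, 0, 0, -1] := by
  have x (i : Fin 6) := hasFDerivAt_apply (𝕜 := ℝ) i m
  have h : HasFDerivAt (F₂ c) _ m :=
    (((((x 0).pow 2).add ((x 1).pow 2)).add (((x 2).pow 2).const_mul c)).const_mul (1 / 2)).sub
      (x 5)
  rw [h.grad_eq]
  funext i
  fin_cases i <;> simp
  ring

theorem grad_F₃ (c : ℝ) (m : Fin 6 → ℝ) :
    grad (F₃ c) m = ![m 3, m 4, c * m 5, m 0, m 1, c * m 2] := by
  have x (i : Fin 6) := hasFDerivAt_apply (𝕜 := ℝ) i m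
  have h : HasFDerivAt (F₃ c) _ m :=
    (((x 0).mul (x 3)).add ((x 1).mul (x 4))).add (((x 2).const_mul c).mul (x 5))
  rw [h.grad_eq]
  funext i
  fin_cases i <;> simp
  ring

theorem grad_F₄ (m : Fin 6 → ℝ) :
    grad F₄ m = ![0, 0, 0, 2 * m 3, 2 * m 4, 2 * m 5] := by
  have x (i : Fin 6) := hasFDerivAt_apply (𝕜 := ℝ) i m
  have h : HasFDerivAt F₄ _ m := (((x 3).pow 2).add ((x 4).pow 2)).add ((x 5).pow 2)
  rw [h.grad_eq]
  funext i
  fin_cases i <;> simp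

theorem grad_h₀ (c : ℝ) (m : Fin 6 → ℝ) :
    grad (h₀ c) m = ![(c - 1) * m 2 * m 3, (c - 1) * m 2 * m 4,
      (c - 1) * (m 2 * (c * m 5) + F₃ c m), m 3 + (c - 1) * m 2 * m 0,
      m 4 + (c - 1) * m 2 * m 1, m 5 + (c - 1) * m 2 * (c * m 2)] := by
  have h : HasFDerivAt (h₀ c) _ m :=
    ((differentiable_F₄ m).hasFDerivAt.const_mul (1 / 2)).add
      (((hasFDerivAt_F₁ m).const_mul (c - 1)).mul (differentiable_F₃ c m).hasFDerivAt)
  have g₃ (i : Fin 6) := congrFun (grad_F₃ c m) i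
  have g₄ (i : Fin 6) := congrFun (grad_F₄ m) i
  simp only [grad] at g₃ g₄
  rw [h.grad_eq]
  funext i
  fin_cases i <;> simp [g₃, g₄, F₁]
  ring

theorem grad_h₁ (c : ℝ) (m : Fin 6 → ℝ) :
    grad (h₁ c) m = ![-m 3 - (c - 1) * m 2 * m 0, -m 4 - (c - 1) * m 2 * m 1,
      -(c * m 5) - (c - 1) * (m 2 * (c * m 2) + F₂ c m), -m 0, -m 1,
      -(c * m 2) + (c - 1) * m 2] := by
  have h : HasFDerivAt (h₁ c) _ m :=
    (differentiable_F₃ c m).hasFDerivAt.neg.sub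
      (((hasFDerivAt_F₁ m).const_mul (c - 1)).mul (differentiable_F₂ c m).hasFDerivAt)
  have g₂ (i : Fin 6) := congrFun (grad_F₂ c m) i
  have g₃ (i : Fin 6) := congrFun (grad_F₃ c m) i
  simp only [grad] at g₂ g₃
  rw [h.grad_eq]
  funext i
  fin_cases i <;> simp [g₂, g₃, F₁]
  ring

theorem grad_h₂ (c : ℝ) (m : Fin 6 → ℝ) :
    grad (h₂ c) m = ![m 0, m 1, c * m 2, 0, 0, -1] :=
  grad_F₂ c m

/-- The Lagrange vector field admits a tri-Hamiltonian formulation: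
`X_L = P₀ ∇h₀ = P₁ ∇h₁ = P₂ ∇h₂`. -/
theorem lagrange_triHamiltonian (c : ℝ) (hc : c ≠ 0) :
    ∀ m : Fin 6 → ℝ,
      P₀ c m *ᵥ grad (h₀ c) m = XL c m ∧
      P₁ m *ᵥ grad (h₁ c) m = XL c m ∧
      P₂ c m *ᵥ grad (h₂ c) m = XL c m := by
  intro m
  rw [grad_h₀, grad_h₁, grad_h₂]
  refine ⟨?_, ?_, ?_⟩ <;> funext i <;> fin_cases i <;>
    simp [P₀, P₁, P₂, XL, Matrix.mulVec, dotProduct, Fin.sum_univ_six] <;> field_simp <;> ring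
end

section
/- Let c be a real constant. The polynomial function H(λ) = (F₄/2) λ² − F₃ λ + F₂ is a Casimir function of the Poisson pencil P₀ − λ P₁ of the Lagrange top: for every λ ∈ ℝ and every point m ∈ ℝ⁶, (P₀(m) − λ P₁(m))·∇( (F₄/2) λ² − F₃ λ + F₂ )(m) = 0. Equivalently, P₁∇(F₄/2) = 0, P₀∇(F₄/2) = P₁∇(−F₃), P₀∇(−F₃) = P₁∇F₂, and P₀∇F₂ = 0 at every point. -/
open Matrix BigOperators

theorem grad_half_F₄ (m : Fin 6 → ℝ) :
    grad (fun y => F₄ y / 2) m = ![0, 0, 0, m 3, m 4, m 5] := by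
  have h : HasFDerivAt (fun y => F₄ y / 2) _ m :=
    (differentiable_F₄ m).hasFDerivAt.mul_const (2 : ℝ)⁻¹
  have h₄ (i : Fin 6) : fderiv ℝ F₄ m (Pi.single i 1) = _ := congrFun (grad_F₄ m) i
  rw [h.grad_eq]
  funext i
  fin_cases i <;> simp [h₄]

theorem grad_neg_F₃ (c : ℝ) (m : Fin 6 → ℝ) :
    grad (fun y => -F₃ c y) m = -grad (F₃ c) m :=
  (differentiable_F₃ c m).hasFDerivAt.fun_neg.grad_eq

theorem grad_pencil (c lam : ℝ) (m : Fin 6 → ℝ) :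
    grad (fun y => (F₄ y / 2) * lam ^ 2 - F₃ c y * lam + F₂ c y) m =
      lam ^ 2 • grad (fun y => F₄ y / 2) m + lam • grad (fun y => -F₃ c y) m + grad (F₂ c) m := by
  have h₄ : DifferentiableAt ℝ (fun y => F₄ y / 2) m := (differentiable_F₄ m).mul_const (2 : ℝ)⁻¹
  have h : HasFDerivAt (fun y => (F₄ y / 2) * lam ^ 2 - F₃ c y * lam + F₂ c y) _ m :=
    ((h₄.hasFDerivAt.mul_const (lam ^ 2)).sub
      ((differentiable_F₃ c m).hasFDerivAt.mul_const lam)).add (differentiable_F₂ c m).hasFDerivAt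
  rw [h.grad_eq, grad_neg_F₃]
  funext i
  simp [grad, sub_eq_add_neg]

theorem P₁_mulVec_grad_half_F₄ (m : Fin 6 → ℝ) : P₁ m *ᵥ grad (fun y => F₄ y / 2) m = 0 := by
  rw [grad_half_F₄]
  funext i
  fin_cases i <;> simp [P₁, mulVec, dotProduct, Fin.sum_univ_succ] <;> ring

theorem P₀_mulVec_grad_half_F₄ (c : ℝ) (m : Fin 6 → ℝ) :
    P₀ c m *ᵥ grad (fun y => F₄ y / 2) m = P₁ m *ᵥ grad (fun y => -F₃ c y) m := by
  rw [grad_half_F₄, grad_neg_F₃, grad_F₃]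
  funext i
  fin_cases i <;> simp [P₀, P₁, mulVec, dotProduct, Fin.sum_univ_succ] <;> ring

theorem P₀_mulVec_grad_neg_F₃ (c : ℝ) (m : Fin 6 → ℝ) :
    P₀ c m *ᵥ grad (fun y => -F₃ c y) m = P₁ m *ᵥ grad (F₂ c) m := by
  rw [grad_neg_F₃, grad_F₃, grad_F₂]
  funext i
  fin_cases i <;> simp [P₀, P₁, mulVec, dotProduct, Fin.sum_univ_succ] <;> ring

theorem P₀_mulVec_grad_F₂ (c : ℝ) (m : Fin 6 → ℝ) : P₀ c m *ᵥ grad (F₂ c) m = 0 := by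
  rw [grad_F₂]
  funext i
  fin_cases i <;> simp [P₀, mulVec, dotProduct, Fin.sum_univ_succ]

/-- `H(λ) = (F₄/2)λ² − F₃λ + F₂` is a Casimir of the Poisson pencil `P₀ − λ P₁`;
equivalently, the corresponding bi-Hamiltonian chain relations hold. -/
theorem casimir_pencil_chain (c : ℝ) :
    (∀ (lam : ℝ) (m : Fin 6 → ℝ),
      (P₀ c m - lam • P₁ m) *ᵥ
        grad (fun y => (F₄ y / 2) * lam ^ 2 - F₃ c y * lam + F₂ c y) m = 0) ∧
    (∀ m : Fin 6 → ℝ,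
      P₁ m *ᵥ grad (fun y => F₄ y / 2) m = 0 ∧
      P₀ c m *ᵥ grad (fun y => F₄ y / 2) m = P₁ m *ᵥ grad (fun y => -F₃ c y) m ∧
      P₀ c m *ᵥ grad (fun y => -F₃ c y) m = P₁ m *ᵥ grad (F₂ c) m ∧
      P₀ c m *ᵥ grad (F₂ c) m = 0) := by
  refine ⟨fun lam m => ?_, fun m => ⟨P₁_mulVec_grad_half_F₄ m, P₀_mulVec_grad_half_F₄ c m,
    P₀_mulVec_grad_neg_F₃ c m, P₀_mulVec_grad_F₂ c m⟩⟩
  simp only [grad_pencil, sub_mulVec, smul_mulVec, mulVec_add, mulVec_smul,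
    P₁_mulVec_grad_half_F₄, P₀_mulVec_grad_half_F₄, P₀_mulVec_grad_neg_F₃, P₀_mulVec_grad_F₂]
  module
end

section
/- Let c be a real constant. Define the bi-Hamiltonian vector fields X₁ = P₁·∇(−F₃) and X₂ = P₁·∇F₂ on ℝ⁶. Then the Lagrange vector field decomposes as X_L(m) = X₁(m) − (c−1) F₁(m) X₂(m) for every m ∈ ℝ⁶, exhibiting the Lagrange top as a Gelfand–Zakharevich system of corank 2. -/
open Matrix BigOperators

/-- The bi-Hamiltonian vector field `X₁ = P₁ ∇(−F₃)`. -/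
noncomputable def X₁ (c : ℝ) (m : Fin 6 → ℝ) : Fin 6 → ℝ :=
  P₁ m *ᵥ grad (fun y => -F₃ c y) m

/-- The bi-Hamiltonian vector field `X₂ = P₁ ∇F₂`. -/
noncomputable def X₂ (c : ℝ) (m : Fin 6 → ℝ) : Fin 6 → ℝ :=
  P₁ m *ᵥ grad (F₂ c) m

theorem grad_neg (H : (Fin 6 → ℝ) → ℝ) (x : Fin 6 → ℝ) :
    grad (fun y => -H y) x = -grad H x := by
  ext i
  simp [grad, fderiv_fun_neg]

/-- The Lagrange vector field decomposes as `X_L = X₁ − (c−1) F₁ X₂`: the Lagrange top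
is a Gelfand–Zakharevich system of corank 2. -/
theorem lagrange_GZ_decomposition (c : ℝ) :
    ∀ m : Fin 6 → ℝ, XL c m = X₁ c m - ((c - 1) * F₁ m) • X₂ c m := by
  intro m
  rw [X₁, X₂, grad_neg, grad_F₂, grad_F₃]
  ext i
  fin_cases i <;> simp [XL, P₁, F₁] <;> ring
end
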